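/- arXiv:math/0701827 — 2 statements merged into one kernel-verified Lean document; each statement's English description precedes it below -/
import Mathlib

section
/- For all integers n ≥ 1 and m ≥ 1, shuffling with one more pack does not increase the distance to uniformity: ‖Q_{n,m+1} − U_n‖_TV ≤ ‖Q_{n,m} − U_n‖_TV. -/
open Filter MeasureTheory
open scoped BigOperators NNReal ENNReal

noncomputable section

/-- The value of `σ⁻¹` at position `i` (0-indexed), as a natural number; `0` out of range. -/
def invAt (n : ℕ) (σ : Equiv.Perm (Fin n)) (i : ℕ) : ℕ :=
  if h : i < n then ((σ⁻¹ ⟨i, h⟩ : Fin n) : ℕ) else 0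

/-- The number of rising sequences of a permutation: one plus the number of descents
of its inverse. -/
def rSeq (n : ℕ) (σ : Equiv.Perm (Fin n)) : ℕ :=
  1 + ((Finset.range (n - 1)).filter fun i => invAt n σ (i + 1) < invAt n σ i).card

/-- The `m`-shuffle distribution on `S_n`:  `Q_{n,m}(σ) = m^{-n} C(n + m - r(σ), n)`. -/
def Qs (n m : ℕ) (σ : Equiv.Perm (Fin n)) : ℝ :=
  ((m : ℝ) ^ n)⁻¹ * (Nat.choose (n + m - rSeq n σ) n : ℝ)

/-- The uniform distribution on `S_n`. -/
def Us (n : ℕ) (_ : Equiv.Perm (Fin n)) : ℝ := (n.factorial : ℝ)⁻¹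

/-- Total variation distance between two probability distributions on `S_n`. -/
def tv (n : ℕ) (μ ν : Equiv.Perm (Fin n) → ℝ) : ℝ :=
  (1 / 2) * ∑ σ : Equiv.Perm (Fin n), |μ σ - ν σ|

/-- Convolution of two distributions on `S_n`. -/
def convol (n : ℕ) (μ ν : Equiv.Perm (Fin n) → ℝ) : Equiv.Perm (Fin n) → ℝ :=
  fun σ => ∑ τ : Equiv.Perm (Fin n), μ (σ * τ⁻¹) * ν τ

/-- `k`-fold convolution power; the `0`-th power is the point mass at the identity. -/
def iterConv (n : ℕ) (μ : Equiv.Perm (Fin n) → ℝ) : ℕ → Equiv.Perm (Fin n) → ℝ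
  | 0 => fun σ => if σ = 1 then 1 else 0
  | k + 1 => convol n μ (iterConv n μ k)

/-- `Ψ(x) = (2π)^{-1/2} ∫_{-x/(4√3)}^{x/(4√3)} e^{-t²/2} dt`. -/
def Psi (x : ℝ) : ℝ :=
  (Real.sqrt (2 * Real.pi))⁻¹ *
    ∫ t in (-(x / (4 * Real.sqrt 3)))..(x / (4 * Real.sqrt 3)), Real.exp (-t ^ 2 / 2)

/-- The `p`-shuffle distribution on `S_n` for a probability `p` on the positive integers. -/
def Qp (n : ℕ) (p : ℕ → ℝ) (σ : Equiv.Perm (Fin n)) : ℝ := ∑' m : ℕ, p m * Qs n m σ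

/-- The number of `i < j` with `¬ D i`. -/
def ascents (D : ℕ → Prop) [DecidablePred D] (j : ℕ) : ℕ :=
  ((Finset.range j).filter fun i => ¬ D i).card

lemma ascents_succ (D : ℕ → Prop) [DecidablePred D] (j : ℕ) :
    ascents D (j + 1) = ascents D j + if D j then 0 else 1 := by
  unfold ascents
  rw [Finset.range_add_one, Finset.filter_insert]
  by_cases h : D j <;> simp [h]

lemma ascents_add_card_filter (D : ℕ → Prop) [DecidablePred D] (j : ℕ) :
    ascents D j + ((Finset.range j).filter D).card = j := by
  have := Finset.card_filter_add_card_filter_not (s := Finset.range j) D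
  rw [Finset.card_range] at this
  unfold ascents
  omega

/-- `g` is weakly increasing, and strictly increasing at the steps where `D` holds. -/
def StrictAt (D : ℕ → Prop) {k m : ℕ} (g : Fin (k + 1) → Fin m) : Prop :=
  ∀ i : Fin k, g i.castSucc < g i.succ ∨ g i.castSucc = g i.succ ∧ ¬ D i

lemma ascents_le_apply (D : ℕ → Prop) [DecidablePred D] {k N : ℕ} {h : Fin (k + 1) → Fin N}
    (hh : StrictMono h) (i : Fin (k + 1)) : ascents D i ≤ h i := by
  induction i using Fin.induction with
  | zero => simp [ascents]
  | succ i ih =>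
    have h1 : (h i.castSucc : ℕ) < h i.succ := hh i.castSucc_lt_succ
    have h2 := ascents_succ D i
    simp only [Fin.val_succ, Fin.val_castSucc] at *
    split_ifs at h2 <;> omega

lemma apply_lt_ascents_add (D : ℕ → Prop) [DecidablePred D] {k m : ℕ}
    {h : Fin (k + 1) → Fin (ascents D k + m)}
    (hh : StrictMono h) (i : Fin (k + 1)) : (h i : ℕ) < ascents D i + m := by
  induction i using Fin.reverseInduction with
  | last => exact (h (Fin.last k)).isLt
  | cast i ih =>
    have h1 : (h i.castSucc : ℕ) < h i.succ := hh i.castSucc_lt_succ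
    have h2 := ascents_succ D i
    simp only [Fin.val_succ, Fin.val_castSucc] at *
    split_ifs at h2 <;> omega

lemma StrictAt.monotone {D : ℕ → Prop} {k m : ℕ} {g : Fin (k + 1) → Fin m} (hg : StrictAt D g) :
    Monotone g :=
  Fin.monotone_iff_le_succ.2 fun i => (hg i).elim le_of_lt fun h => h.1.le

/-- Adding the number of preceding ascents turns a sequence that is strict at `D` into a strictly
increasing one. -/
def strictAtEquiv (D : ℕ → Prop) [DecidablePred D] (k m : ℕ) :
    {g : Fin (k + 1) → Fin m // StrictAt D g} ≃ (Fin (k + 1) ↪o Fin (ascents D k + m)) where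
  toFun g := OrderEmbedding.ofStrictMono
    (fun i => ⟨ascents D i + g.1 i, add_lt_add_of_le_of_lt
      (Finset.card_le_card (Finset.filter_subset_filter _
        (Finset.range_subset_range.2 i.is_le))) (g.1 i).isLt⟩) <| by
    refine Fin.strictMono_iff_lt_succ.2 fun i => ?_
    have h1 := g.2 i
    have h2 := ascents_succ D i
    simp only [Fin.lt_def, Fin.ext_iff, Fin.val_succ, Fin.val_castSucc] at *
    split_ifs at h2 with h <;>
      simp only [h, not_true, and_false, or_false, not_false_eq_true, and_true] at h1 <;> omega
  invFun h := ⟨fun i => ⟨h i - ascents D i, by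
      have h1 := ascents_le_apply D h.strictMono i
      have h2 := apply_lt_ascents_add D h.strictMono i
      omega⟩, by
    intro i
    have h1 : (h i.castSucc : ℕ) < h i.succ := h.strictMono i.castSucc_lt_succ
    have h2 := ascents_succ D i
    have h3 := ascents_le_apply D h.strictMono i.castSucc
    simp only [Fin.lt_def, Fin.ext_iff, Fin.val_succ, Fin.val_castSucc] at *
    split_ifs at h2 with h <;>
      simp only [h, not_true, and_false, or_false, not_false_eq_true, and_true] <;> omega⟩
  left_inv g := by
    ext i
    simp
  right_inv h := by
    ext i
    have h1 := ascents_le_apply D h.strictMono i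
    simp only [OrderEmbedding.coe_ofStrictMono]
    omega

lemma card_strictAt (D : ℕ → Prop) [DecidablePred D] (k m : ℕ) :
    Nat.card {g : Fin (k + 1) → Fin m // StrictAt D g} =
      (ascents D k + m).choose (k + 1) := by
  rw [Nat.card_congr ((strictAtEquiv D k m).trans Set.powersetCard.ofFinEmbEquiv),
    Set.powersetCard.card, Nat.card_fin]

lemma sort_eq_inv_iff {k m : ℕ} (σ : Equiv.Perm (Fin (k + 1))) (f : Fin (k + 1) → Fin m) :
    Tuple.sort f = σ⁻¹ ↔
      StrictAt (fun i => invAt (k + 1) σ (i + 1) < invAt (k + 1) σ i) (f ∘ ⇑σ⁻¹) := by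
  rw [eq_comm, Tuple.eq_sort_iff', Fin.strictMono_iff_lt_succ]
  refine forall_congr' fun i => ?_
  have hne : σ⁻¹ i.castSucc ≠ σ⁻¹ i.succ := fun h => i.castSucc_lt_succ.ne (σ⁻¹.injective h)
  have h1 : invAt (k + 1) σ i = σ⁻¹ i.castSucc := by
    rw [invAt, dif_pos (by omega)]; rfl
  have h2 : invAt (k + 1) σ (i + 1) = σ⁻¹ i.succ := by
    rw [invAt, dif_pos (by omega)]; rfl
  beta_reduce
  rw [h1, h2]
  change toLex (f (σ⁻¹ i.castSucc), σ⁻¹ i.castSucc) < toLex (f (σ⁻¹ i.succ), σ⁻¹ i.succ) ↔ _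
  rw [Prod.Lex.toLex_lt_toLex]
  simp only [Function.comp_apply, not_lt, Fin.val_fin_le, hne.le_iff_lt]

lemma card_sort_eq_inv {k m : ℕ} (σ : Equiv.Perm (Fin (k + 1))) :
    Nat.card {f : Fin (k + 1) → Fin m // Tuple.sort f = σ⁻¹} =
      (k + 1 + m - rSeq (k + 1) σ).choose (k + 1) := by
  set D : ℕ → Prop := fun i => invAt (k + 1) σ (i + 1) < invAt (k + 1) σ i with hD
  have e : {f : Fin (k + 1) → Fin m // Tuple.sort f = σ⁻¹} ≃
      {g : Fin (k + 1) → Fin m // StrictAt D g} :=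
    (Equiv.arrowCongr σ (Equiv.refl (Fin m))).subtypeEquiv fun f => sort_eq_inv_iff σ f
  have h1 : rSeq (k + 1) σ = 1 + ((Finset.range k).filter D).card := rfl
  have h2 := ascents_add_card_filter D k
  rw [Nat.card_congr e, card_strictAt]
  congr 1
  omega

/-- Worpitzky's identity, summed over permutations. -/
lemma sum_choose_rSeq (n m : ℕ) (hn : 1 ≤ n) :
    ∑ σ : Equiv.Perm (Fin n), (n + m - rSeq n σ).choose n = m ^ n := by
  obtain ⟨k, rfl⟩ := Nat.exists_eq_add_of_le' hn
  have h := Nat.card_congr (Equiv.sigmaFiberEquiv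
    fun f : Fin (k + 1) → Fin m => (Tuple.sort f)⁻¹)
  rw [Nat.card_sigma] at h
  simp only [inv_eq_iff_eq_inv, card_sort_eq_inv] at h
  simpa using h

lemma sum_Qs (n m : ℕ) (hn : 1 ≤ n) (hm : 1 ≤ m) : ∑ σ, Qs n m σ = 1 := by
  unfold Qs
  rw [← Finset.mul_sum, ← Nat.cast_sum, sum_choose_rSeq n m hn, Nat.cast_pow]
  exact inv_mul_cancel₀ (by positivity)

lemma sum_Us (n : ℕ) : ∑ σ, Us n σ = 1 := by
  simp [Us, Fintype.card_perm, Nat.factorial_ne_zero]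

lemma one_le_rSeq (n : ℕ) (σ : Equiv.Perm (Fin n)) : 1 ≤ rSeq n σ := Nat.le_add_right _ _

lemma Qs_le_of_rSeq_le {n m : ℕ} {σ τ : Equiv.Perm (Fin n)} (h : rSeq n σ ≤ rSeq n τ) :
    Qs n m τ ≤ Qs n m σ := by
  unfold Qs
  gcongr

lemma Qs_nonneg (n m : ℕ) (σ : Equiv.Perm (Fin n)) : 0 ≤ Qs n m σ := by
  unfold Qs; positivity

lemma Qs_eq_zero {n m : ℕ} (hn : 1 ≤ n) {σ : Equiv.Perm (Fin n)} (h : m < rSeq n σ) :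
    Qs n m σ = 0 := by
  rw [Qs, Nat.choose_eq_zero_of_lt (by omega), Nat.cast_zero, mul_zero]

lemma Qs_pos {n m : ℕ} {σ : Equiv.Perm (Fin n)} (h : rSeq n σ ≤ m) : 0 < Qs n m σ := by
  have h1 : 0 < (n + m - rSeq n σ).choose n := Nat.choose_pos (by omega)
  have h2 := one_le_rSeq n σ
  have h3 : 0 < m := by omega
  unfold Qs
  positivity

/-- The ratio of consecutive shuffle densities, in cross-multiplied form. -/
lemma Qs_succ_mul {n m : ℕ} (hm : 1 ≤ m) {σ : Equiv.Perm (Fin n)} (h : rSeq n σ ≤ m) :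
    Qs n (m + 1) σ * (((m : ℝ) + 1) ^ n * (m + 1 - rSeq n σ)) =
      Qs n m σ * ((m : ℝ) ^ n * (n + m + 1 - rSeq n σ)) := by
  have h1 := Nat.choose_mul_succ_eq (n + m - rSeq n σ) n
  have h2 : n + m - rSeq n σ + 1 = n + (m + 1) - rSeq n σ := by omega
  rw [h2] at h1
  have h3 := congrArg (Nat.cast (R := ℝ)) h1
  rw [Nat.cast_mul, Nat.cast_mul, Nat.cast_sub (by omega), Nat.cast_sub (by omega),
    Nat.cast_sub (by omega)] at h3
  push_cast at h3
  have h4 : (m : ℝ) ≠ 0 := by positivity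
  have h5 : (m : ℝ) + 1 ≠ 0 := by positivity
  unfold Qs
  push_cast
  field_simp
  linear_combination -h3

/-- The shuffle densities for `m` and `m + 1` packs cross at most once. -/
lemma Qs_le_Qs_succ_of_lt {n m : ℕ} (hn : 1 ≤ n) (hm : 1 ≤ m) {σ τ : Equiv.Perm (Fin n)}
    (hστ : rSeq n σ ≤ rSeq n τ) (h : Qs n m σ < Qs n (m + 1) σ) :
    Qs n m τ ≤ Qs n (m + 1) τ := by
  rcases lt_or_ge m (rSeq n τ) with hτ | hτ
  · rw [Qs_eq_zero hn hτ]
    exact Qs_nonneg _ _ _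
  have hσ := hστ.trans hτ
  have eσ := Qs_succ_mul hm hσ
  have eτ := Qs_succ_mul hm hτ
  have pσ := Qs_pos hσ
  have pτ := Qs_pos hτ
  have rσ : (rSeq n σ : ℝ) ≤ m := by exact_mod_cast hσ
  have rτ : (rSeq n τ : ℝ) ≤ m := by exact_mod_cast hτ
  have rστ : (rSeq n σ : ℝ) ≤ rSeq n τ := by exact_mod_cast hστ
  have hpow : (m : ℝ) ^ n ≤ ((m : ℝ) + 1) ^ n := by gcongr; linarith
  have posσ : 0 < ((m : ℝ) + 1) ^ n * (m + 1 - rSeq n σ) :=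
    mul_pos (by positivity) (by linarith)
  have posτ : 0 < ((m : ℝ) + 1) ^ n * (m + 1 - rSeq n τ) :=
    mul_pos (by positivity) (by linarith)
  have cσ : ((m : ℝ) + 1) ^ n * (m + 1 - rSeq n σ) < (m : ℝ) ^ n * (n + m + 1 - rSeq n σ) :=
    lt_of_mul_lt_mul_left (eσ ▸ mul_lt_mul_of_pos_right h posσ) pσ.le
  have cτ : ((m : ℝ) + 1) ^ n * (m + 1 - rSeq n τ) ≤ (m : ℝ) ^ n * (n + m + 1 - rSeq n τ) := by
    nlinarith [mul_le_mul_of_nonneg_right hpow (sub_nonneg.2 rστ)]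
  exact le_of_mul_le_mul_right (eτ ▸ mul_le_mul_of_nonneg_left cτ pτ.le) posτ

lemma sum_filter_Qs_succ_le {n m : ℕ} (hn : 1 ≤ n) (hm : 1 ≤ m)
    (p : Equiv.Perm (Fin n) → Prop) [DecidablePred p]
    (hp : ∀ σ τ, p σ → ¬ p τ → rSeq n σ ≤ rSeq n τ) :
    ∑ σ with p σ, Qs n (m + 1) σ ≤ ∑ σ with p σ, Qs n m σ := by
  by_cases h : ∃ σ, p σ ∧ Qs n m σ < Qs n (m + 1) σ
  · obtain ⟨σ, hσ, hlt⟩ := h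
    have h1 : ∑ τ with ¬ p τ, Qs n m τ ≤ ∑ τ with ¬ p τ, Qs n (m + 1) τ :=
      Finset.sum_le_sum fun τ hτ =>
        Qs_le_Qs_succ_of_lt hn hm (hp σ τ hσ (Finset.mem_filter.1 hτ).2) hlt
    have h2 := Finset.sum_filter_add_sum_filter_not Finset.univ p (Qs n m)
    have h3 := Finset.sum_filter_add_sum_filter_not Finset.univ p (Qs n (m + 1))
    rw [sum_Qs n m hn hm] at h2
    rw [sum_Qs n (m + 1) hn (by omega)] at h3
    linarith
  · push Not at h
    exact Finset.sum_le_sum fun σ hσ => h σ (Finset.mem_filter.1 hσ).2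

lemma sum_abs_le_sum_abs_of_sum_pos_le {ι : Type*} [Fintype ι] {x y : ι → ℝ}
    (hx : ∑ i, x i = 0) (hy : ∑ i, y i = 0)
    (h : ∑ i with 0 < x i, x i ≤ ∑ i with 0 < x i, y i) :
    ∑ i, |x i| ≤ ∑ i, |y i| := by
  have h1 := Finset.sum_filter_add_sum_filter_not Finset.univ (fun i => 0 < x i) x
  have h2 := Finset.sum_filter_add_sum_filter_not Finset.univ (fun i => 0 < x i) y
  have h3 := Finset.sum_filter_add_sum_filter_not Finset.univ (fun i => 0 < x i) fun i => |x i|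
  have h4 := Finset.sum_filter_add_sum_filter_not Finset.univ (fun i => 0 < x i) fun i => |y i|
  have h5 : ∑ i with 0 < x i, |x i| = ∑ i with 0 < x i, x i :=
    Finset.sum_congr rfl fun i hi => abs_of_pos (Finset.mem_filter.1 hi).2
  have h6 : ∑ i with ¬ 0 < x i, |x i| = -∑ i with ¬ 0 < x i, x i := by
    rw [← Finset.sum_neg_distrib]
    exact Finset.sum_congr rfl fun i hi => abs_of_nonpos (not_lt.1 (Finset.mem_filter.1 hi).2)
  have h7 : ∑ i with 0 < x i, y i ≤ ∑ i with 0 < x i, |y i| :=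
    Finset.sum_le_sum fun i _ => le_abs_self _
  have h8 : -∑ i with ¬ 0 < x i, y i ≤ ∑ i with ¬ 0 < x i, |y i| := by
    rw [← Finset.sum_neg_distrib]
    exact Finset.sum_le_sum fun i _ => neg_le_abs _
  linarith

/-- Shuffling with one more pack does not increase the distance to uniformity. -/
theorem tv_antitone_in_packs (n m : ℕ) (hn : 1 ≤ n) (hm : 1 ≤ m) :
    tv n (Qs n (m + 1)) (Us n) ≤ tv n (Qs n m) (Us n) := by
  unfold tv
  refine mul_le_mul_of_nonneg_left (sum_abs_le_sum_abs_of_sum_pos_le ?_ ?_ ?_) (by norm_num)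
  · rw [Finset.sum_sub_distrib, sum_Qs n (m + 1) hn (by omega), sum_Us, sub_self]
  · rw [Finset.sum_sub_distrib, sum_Qs n m hn hm, sum_Us, sub_self]
  · rw [Finset.sum_sub_distrib, Finset.sum_sub_distrib]
    refine sub_le_sub_right (sum_filter_Qs_succ_le hn hm _ fun σ τ hσ hτ => ?_) _
    contrapose! hτ
    exact hσ.trans_le (sub_le_sub_right (Qs_le_of_rSeq_le hτ.le) _)
end
end

section
/- For all integers n ≥ 1, m ≥ 1 and r ∈ {1,…,n}, if Q_{n,m}(r) > 1/n! then Q_{n,k}(r) > 1/n! for every integer k ≥ m. -/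
noncomputable section

/-- `Q_{n,m}(r) = m^{-n} C(n + m - r, n)`. -/
def Qr (n m r : ℕ) : ℝ := ((m : ℝ) ^ n)⁻¹ * (Nat.choose (n + m - r) n : ℝ)

/-- `n! Q_{n,m}(r)` as a product of factors affine in `1 / m`. -/
theorem factorial_mul_Qr (n m r : ℕ) (hm : 1 ≤ m) (hrm : r ≤ m) :
    (n.factorial : ℝ) * Qr n m r =
      ∏ i ∈ Finset.range n, (1 + ((i : ℝ) + 1 - r) / m) := by
  have hm0 : (m : ℝ) ≠ 0 := by positivity
  have hc : (n.factorial : ℝ) * ((n + m - r).choose n : ℝ) =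
      ∏ i ∈ Finset.range n, ((m : ℝ) - r + 1 + i) := by
    have h := Nat.ascFactorial_eq_factorial_mul_choose (m - r) n
    rw [Nat.ascFactorial_eq_prod_range, show m - r + n = n + m - r by omega] at h
    rw [← Nat.cast_mul, ← h]
    push_cast [Nat.cast_sub hrm]
    rfl
  have hp : ∏ i ∈ Finset.range n, (1 + ((i : ℝ) + 1 - r) / m) =
      ∏ i ∈ Finset.range n, (((m : ℝ) - r + 1 + i) / m) :=
    Finset.prod_congr rfl fun i _ => by field_simp; ring
  rw [hp, Finset.prod_div_distrib, ← hc, Finset.prod_const, Finset.card_range, Qr]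
  ring

/-- Shrinking all the `a i` by a factor `t ∈ [0, 1]` raises `∏ (1 + a i)` to a power at most `t`. -/
theorem rpow_prod_one_add_le_prod_one_add_mul {ι : Type*} (s : Finset ι) (a : ι → ℝ)
    (ha : ∀ i ∈ s, -1 ≤ a i) {t : ℝ} (ht0 : 0 ≤ t) (ht1 : t ≤ 1) :
    (∏ i ∈ s, (1 + a i)) ^ t ≤ ∏ i ∈ s, (1 + t * a i) := by
  have hnn : ∀ i ∈ s, 0 ≤ 1 + a i := fun i hi => by linarith [ha i hi]
  rw [← Real.finsetProd_rpow s _ hnn]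
  exact Finset.prod_le_prod (fun i hi => Real.rpow_nonneg (hnn i hi) t) fun i hi =>
    rpow_one_add_le_one_add_mul_self (ha i hi) ht0 ht1

/-- If `Q_{n,m}(r) > 1/n!` then `Q_{n,k}(r) > 1/n!` for all `k ≥ m`. -/
theorem Qr_gt_uniform_of_gt (n m r : ℕ) (hn : 1 ≤ n) (hm : 1 ≤ m)
    (hr : 1 ≤ r) (hrn : r ≤ n) (h : (n.factorial : ℝ)⁻¹ < Qr n m r) :
    ∀ k : ℕ, m ≤ k → (n.factorial : ℝ)⁻¹ < Qr n k r := by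
  intro k hk
  have hfac : (0 : ℝ) < n.factorial := by positivity
  have hrm : r ≤ m := by
    by_contra! hlt
    rw [Qr, Nat.choose_eq_zero_of_lt (by omega), Nat.cast_zero, mul_zero] at h
    exact absurd h (not_lt.mpr (by positivity))
  have hm0 : (0 : ℝ) < m := by positivity
  have hk0 : (0 : ℝ) < k := by exact_mod_cast hm.trans hk
  have hmk : (m : ℝ) ≤ k := by exact_mod_cast hk
  have hrm' : (r : ℝ) ≤ m := by exact_mod_cast hrm
  rw [inv_lt_iff_one_lt_mul₀' hfac] at h ⊢
  rw [factorial_mul_Qr n m r hm hrm] at h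
  rw [factorial_mul_Qr n k r (hm.trans hk) (hrm.trans hk)]
  calc (1 : ℝ) < (∏ i ∈ Finset.range n, (1 + ((i : ℝ) + 1 - r) / m)) ^ ((m : ℝ) / k) :=
        Real.one_lt_rpow h (by positivity)
    _ ≤ ∏ i ∈ Finset.range n, (1 + (m : ℝ) / k * (((i : ℝ) + 1 - r) / m)) := by
        refine rpow_prod_one_add_le_prod_one_add_mul _ _ (fun i _ => ?_) (by positivity)
          ((div_le_one hk0).mpr hmk)
        rw [le_div_iff₀ hm0]
        linarith [(Nat.cast_nonneg i : (0 : ℝ) ≤ i)]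
    _ = ∏ i ∈ Finset.range n, (1 + ((i : ℝ) + 1 - r) / k) :=
        Finset.prod_congr rfl fun i _ => by field_simp
end
end
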